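/- If ω ∈ ⋀^p k^n is decomposable, then P'_{A,B,C}(ω) = 0 for every choice of A = {α_1,α_2,α_3,α_4} ⊂ {1,…,n}, B = {β⃗_1,…,β⃗_m} with β⃗_i ∈ {1,…,n}^2 (0 ≤ m ≤ p−2), and C = {γ_1,…,γ_{p−m−2}} ⊂ {1,…,n}. -/

import Mathlib

open ExteriorAlgebra

noncomputable section

variable (k : Type*) [Field k]

/-- The alternating map giving the coordinate `Π_idx` (antisymmetric in `idx`). -/
def coordA {n : ℕ} (q : ℕ) (idx : Fin q → Fin n) :
    (Fin n → k) [⋀^Fin q]→ₗ[k] k :=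
  (Matrix.detRowAlternating : (Fin q → k) [⋀^Fin q]→ₗ[k] k).compLinearMap
    (LinearMap.funLeft k k idx)

/-- The coordinate functional `Π_idx` on the exterior algebra. -/
def coordF {n : ℕ} (q : ℕ) (idx : Fin q → Fin n) :
    ExteriorAlgebra k (Fin n → k) →ₗ[k] k :=
  ExteriorAlgebra.liftAlternating
    (Function.update (fun i => (0 : (Fin n → k) [⋀^Fin i]→ₗ[k] k)) q (coordA k q idx))

/-- Decomposability of an element of the exterior algebra, in degree `q`. -/
def IsDecomp {n : ℕ} (q : ℕ) (x : ExteriorAlgebra k (Fin n → k)) : Prop :=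
  ∃ v : Fin q → (Fin n → k), x = ExteriorAlgebra.ιMulti k q v

/-- The dual isomorphism `δ` on the degree-`p` part, with values in degree `n-p`. -/
def dualAt (n p : ℕ) (ω : ExteriorAlgebra k (Fin n → k)) :
    ExteriorAlgebra k (Fin n → k) :=
  ∑ s : {s : Finset (Fin n) // s.card = p},
    coordF k p (fun a => (s.1.orderIsoOfFin s.2 a : Fin n)) ω •
      ExteriorAlgebra.ιMulti k (n - p)
        (fun a => Pi.single (((s.1ᶜ).orderIsoOfFin
          (by rw [Finset.card_compl, s.2, Fintype.card_fin]) a : Fin n)) (1 : k))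

/-- The index tuple `(α_i, α_j, β_1^{ε_1}, …, β_m^{ε_m}, γ_1, …, γ_c)`. -/
def tupleP {n : ℕ} (m c : ℕ) (α : Fin 4 → Fin n) (β : Fin m → Fin 2 → Fin n)
    (γ : Fin c → Fin n) (i j : Fin 4) (ε : Fin m → Fin 2) : Fin (2 + (m + c)) → Fin n :=
  Fin.append ![α i, α j] (Fin.append (fun l => β l (ε l)) γ)

/-- The functional `π_{ij} = Π_{α_i α_j β⃗_1 … β⃗_m γ_1 … γ_c}`. -/
def piF {n : ℕ} (m c : ℕ) (α : Fin 4 → Fin n) (β : Fin m → Fin 2 → Fin n)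
    (γ : Fin c → Fin n) (i j : Fin 4) :
    ExteriorAlgebra k (Fin n → k) →ₗ[k] k :=
  ∑ ε : Fin m → Fin 2, coordF k (2 + (m + c)) (tupleP m c α β γ i j ε)

/-- The rank 6 quadratic form `P'_{A,B,C}`. -/
def Pprime {n : ℕ} (m c : ℕ) (α : Fin 4 → Fin n) (β : Fin m → Fin 2 → Fin n)
    (γ : Fin c → Fin n) (ω : ExteriorAlgebra k (Fin n → k)) : k :=
  piF k m c α β γ 0 1 ω * piF k m c α β γ 2 3 ω
    - piF k m c α β γ 0 2 ω * piF k m c α β γ 1 3 ω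
    + piF k m c α β γ 0 3 ω * piF k m c α β γ 1 2 ω

/-- The ordering/distinctness conditions on the triple `(A,B,C)`. -/
def OrderedABC {n : ℕ} (m c : ℕ) (α : Fin 4 → Fin n) (β : Fin m → Fin 2 → Fin n)
    (γ : Fin c → Fin n) : Prop :=
  Function.Injective (Sum.elim α (Sum.elim (fun x : Fin m × Fin 2 => β x.1 x.2) γ)) ∧
    StrictMono α ∧ (∀ l, β l 0 < β l 1) ∧
    (∀ ν : Fin 2, StrictMono fun l => β l ν) ∧
    (∀ l, β l 0 < α 0) ∧ (∀ l, β l 1 < α 2) ∧ StrictMono γ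

/-- The set `S' = A ∪ B_1 ∪ C`. -/
def SP {n : ℕ} (m c : ℕ) (α : Fin 4 → Fin n) (β : Fin m → Fin 2 → Fin n)
    (γ : Fin c → Fin n) : Finset (Fin n) :=
  Finset.univ.image α ∪ Finset.univ.image (fun l => β l 1) ∪ Finset.univ.image γ

open Classical in
/-- The matrix of the map `X_{A,B,C} : k^n → k^{p+2}`. -/
def Xmat (p : ℕ) {n : ℕ} (m c : ℕ) (α : Fin 4 → Fin n) (β : Fin m → Fin 2 → Fin n)
    (γ : Fin c → Fin n) : Matrix (Fin (p + 2)) (Fin n) k :=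
  if h : (SP m c α β γ).card = p + 2 then
    fun j i =>
      (if i = ((SP m c α β γ).orderIsoOfFin h j : Fin n) then 1 else 0) +
        ∑ l : Fin m,
          if i = β l 0 ∧ β l 1 = ((SP m c α β γ).orderIsoOfFin h j : Fin n) then 1 else 0
  else 0

/-- The linear map `X_{A,B,C} : k^n → k^{p+2}`. -/
def XL (p : ℕ) {n : ℕ} (m c : ℕ) (α : Fin 4 → Fin n) (β : Fin m → Fin 2 → Fin n)
    (γ : Fin c → Fin n) : (Fin n → k) →ₗ[k] (Fin (p + 2) → k) :=
  (Xmat k p m c α β γ).mulVecLin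

open Classical in
/-- The matrix of the map `Z : k^{p+2} → k^4`. -/
def Zmat (p : ℕ) {n : ℕ} (m c : ℕ) (α : Fin 4 → Fin n) (β : Fin m → Fin 2 → Fin n)
    (γ : Fin c → Fin n) : Matrix (Fin 4) (Fin (p + 2)) k :=
  fun j i => if XL k p m c α β γ (Pi.single (α j) 1) = Pi.single i 1 then 1 else 0

/-- The linear map `Z : k^{p+2} → k^4`. -/
def ZL (p : ℕ) {n : ℕ} (m c : ℕ) (α : Fin 4 → Fin n) (β : Fin m → Fin 2 → Fin n)
    (γ : Fin c → Fin n) : (Fin (p + 2) → k) →ₗ[k] (Fin 4 → k) :=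
  (Zmat k p m c α β γ).mulVecLin

/-- The Grassmann cone preserving map `G_{A,B,C} = ⋀²Z ∘ δ ∘ ⋀^p X_{A,B,C}`. -/
def GABC (p : ℕ) {n : ℕ} (m c : ℕ) (α : Fin 4 → Fin n) (β : Fin m → Fin 2 → Fin n)
    (γ : Fin c → Fin n) (ω : ExteriorAlgebra k (Fin n → k)) :
    ExteriorAlgebra k (Fin 4 → k) :=
  ExteriorAlgebra.map (ZL k p m c α β γ)
    (dualAt k (p + 2) p (ExteriorAlgebra.map (XL k p m c α β γ) ω))

/-- The general Plücker quadratic form `P_{A,B}` for index sequences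
`a : Fin d → Fin n` and `b : Fin (e+1) → Fin n`. -/
def Pluecker {n : ℕ} (d e : ℕ) (a : Fin d → Fin n) (b : Fin (e + 1) → Fin n)
    (ω : ExteriorAlgebra k (Fin n → k)) : k :=
  ∑ i : Fin (e + 1), (-1 : k) ^ (i : ℕ) *
    (coordF k (d + 1) (Fin.snoc a (b i)) ω * coordF k e (fun j => b (i.succAbove j)) ω)

open Matrix in
/-- Cramer's rule for rows. -/
theorem Matrix.sum_det_updateRow_smul_row {R ι : Type*} [CommRing R] [Fintype ι] [DecidableEq ι]
    (A : Matrix ι ι R) (b : ι → R) :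
    ∑ l, (A.updateRow l b).det • A l = A.det • b := by
  have h := mulVec_cramer Aᵀ b
  rw [det_transpose] at h
  rw [← h]
  ext r
  simp [mulVec, dotProduct, cramer_transpose_apply, mul_comm]

/-- The three-term Plücker relation for determinants with two varying rows. -/
theorem Matrix.det_updateRow_updateRow_three_term {R ι : Type*} [CommRing R] [Fintype ι]
    [DecidableEq ι] (N : Matrix ι ι R) {i j : ι} (hij : i ≠ j) (x₁ x₂ x₃ x₄ : ι → R) :
    ((N.updateRow i x₁).updateRow j x₂).det * ((N.updateRow i x₃).updateRow j x₄).det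
      - ((N.updateRow i x₁).updateRow j x₃).det * ((N.updateRow i x₂).updateRow j x₄).det
      + ((N.updateRow i x₁).updateRow j x₄).det * ((N.updateRow i x₂).updateRow j x₃).det
      = 0 := by
  have hswap (x y : ι → R) : ((N.updateRow i x).updateRow j y).det
      = -((N.updateRow i y).updateRow j x).det := by
    have h := Matrix.det_permute (Equiv.swap i j) ((N.updateRow i y).updateRow j x)
    rw [Equiv.Perm.sign_swap hij] at h
    simp only [Units.val_neg, Units.val_one, Int.cast_neg, Int.cast_one, neg_mul, one_mul] at h
    rw [← h]
    congr 1
    ext a b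
    rcases eq_or_ne a i with rfl | hi
    · simp [hij]
    rcases eq_or_ne a j with rfl | hj
    · simp [hij]
    simp [hi, hj, Equiv.swap_apply_of_ne_of_ne hi hj]
  let L := Matrix.detRowAlternating.toMultilinearMap.toLinearMap (N.updateRow j x₄) i
  have hL (z : ι → R) : L z = ((N.updateRow i z).updateRow j x₄).det := by
    rw [Matrix.updateRow_comm _ hij]
    rfl
  have key := congrArg L (Matrix.sum_det_updateRow_smul_row
    ((N.updateRow i x₁).updateRow j x₂) x₃)
  simp only [map_sum, map_smul] at key
  simp only [hL, smul_eq_mul] at key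
  rw [Finset.sum_eq_add i j hij] at key
  · have hi : ((N.updateRow i x₁).updateRow j x₂).updateRow i x₃
        = (N.updateRow i x₃).updateRow j x₂ := by
      rw [← Matrix.updateRow_comm _ hij, Matrix.updateRow_idem]
    rw [hi, Matrix.updateRow_idem, Matrix.updateRow_self, Matrix.updateRow_ne hij,
      Matrix.updateRow_self, hswap x₃ x₂] at key
    linear_combination -key
  · rintro l - ⟨hli, hlj⟩
    refine mul_eq_zero_of_right _ (Matrix.det_zero_of_row_eq hli.symm ?_)
    rw [Matrix.updateRow_ne hlj, Matrix.updateRow_ne hli,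
      Matrix.updateRow_ne hij, Matrix.updateRow_self, Matrix.updateRow_ne hlj,
      Matrix.updateRow_ne hli]
  · simp
  · simp

theorem MultilinearMap.sum_map_append_append {R M N ι : Type*} [CommSemiring R] [AddCommMonoid M]
    [AddCommMonoid N] [Module R M] [Module R N] [Fintype ι] {q m c : ℕ}
    (f : MultilinearMap R (fun _ : Fin (q + (m + c)) => M) N)
    (x : Fin q → M) (y : Fin m → ι → M) (z : Fin c → M) :
    ∑ ε : Fin m → ι, f (Fin.append x (Fin.append (fun l => y l (ε l)) z))
      = f (Fin.append x (Fin.append (fun l => ∑ a, y l a) z)) := by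
  let g := (((f.domDomCongr finSumFinEquiv.symm).currySum x).domDomCongr
    finSumFinEquiv.symm).currySum
  have hg (u : Fin m → M) : g u z = f (Fin.append x (Fin.append u z)) := by
    simp only [g, MultilinearMap.currySum_apply', MultilinearMap.domDomCongr_apply]
    congr 1
    ext s
    refine Fin.addCases (fun s => ?_) (fun s => ?_) s
    · simp
    · refine Fin.addCases (fun s => ?_) (fun s => ?_) s <;> simp
  simp only [← hg]
  rw [g.map_sum, sum_apply]

theorem coordF_ιMulti {k : Type*} [Field k] {n q : ℕ} (idx : Fin q → Fin n)
    (v : Fin q → Fin n → k) :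
    coordF k q idx (ExteriorAlgebra.ιMulti k q v)
      = Matrix.detRowAlternating fun s r => v r (idx s) := by
  rw [coordF, ExteriorAlgebra.liftAlternating_apply_ιMulti, Function.update_self]
  exact (Matrix.det_transpose _).symm

theorem piF_ιMulti {k : Type*} [Field k] {n m c : ℕ} (α : Fin 4 → Fin n)
    (β : Fin m → Fin 2 → Fin n) (γ : Fin c → Fin n) (i j : Fin 4)
    (v : Fin (2 + (m + c)) → Fin n → k) :
    piF k m c α β γ i j (ExteriorAlgebra.ιMulti k (2 + (m + c)) v)
      = Matrix.det (Fin.append ![fun r => v r (α i), fun r => v r (α j)]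
          (Fin.append (fun l => ∑ a, fun r => v r (β l a)) fun l r => v r (γ l))) := by
  simp only [piF, LinearMap.sum_apply, coordF_ιMulti]
  refine Eq.trans (Finset.sum_congr rfl fun ε _ => congrArg _ ?_)
    (MultilinearMap.sum_map_append_append Matrix.detRowAlternating.toMultilinearMap
      ![fun r => v r (α i), fun r => v r (α j)] (fun l a r => v r (β l a)) fun l r => v r (γ l))
  funext s
  refine Fin.addCases (fun s => ?_) (fun s => ?_) s
  · fin_cases s <;> simp [tupleP]
  · refine Fin.addCases (fun s => ?_) (fun s => ?_) s <;> simp [tupleP]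

theorem Fin.append_pair_eq_update {M : Type*} {q : ℕ} (x y x' y' : M) (u : Fin q → M) :
    Fin.append ![x, y] u
      = Function.update (Function.update (Fin.append ![x', y'] u) (Fin.castAdd q 0) x)
          (Fin.castAdd q 1) y := by
  funext s
  refine Fin.addCases (fun s => ?_) (fun s => ?_) s
  · fin_cases s <;> simp
  · have h (t : Fin 2) : Fin.natAdd 2 s ≠ Fin.castAdd q t := by
      simp only [ne_eq, Fin.ext_iff, Fin.val_natAdd, Fin.val_castAdd]
      omega
    simp [h]

/-- If `ω ∈ ⋀^p k^n` is decomposable then `P'_{A,B,C}(ω) = 0` for every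
choice of `A`, `B`, `C`. -/
theorem Pprime_eq_zero_of_decomposable
    {k : Type*} [Field k] {p n : ℕ}
    (ω : ⋀[k]^p (Fin n → k)) (hω : IsDecomp k p ω.val)
    (m c : ℕ) (α : Fin 4 → Fin n) (β : Fin m → Fin 2 → Fin n) (γ : Fin c → Fin n)
    (hmc : 2 + (m + c) = p)
    (hα : Function.Injective α) (hβ : Function.Injective β)
    (hγ : Function.Injective γ) :
    Pprime k m c α β γ ω.val = 0 := by
  subst hmc
  obtain ⟨v, hv⟩ := hω
  simp only [Pprime, hv, piF_ιMulti]
  simp only [Fin.append_pair_eq_update (fun r => v r (α _)) (fun r => v r (α _)) 0 0]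
  exact Matrix.det_updateRow_updateRow_three_term _
    (by simp [Fin.ext_iff]) _ _ _ _

end
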